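/- arXiv:1311.5244 — 3 statements merged into one kernel-verified Lean document; each statement's English description precedes it below -/
import Mathlib

section
/- Let λ ≥ 2, n ∈ ℝ² nonzero, and let H be a law on ℝ² with continuous, strictly positive density h. For δ > 0 define h*_δ(x) = λ · (h(x)𝟙_{L_δ}(x)/H(L_δ)) · H_δ((−∞,[x]_1)×ℝ)^{λ−1}, c_δ(x) = δ − n^⊤x, and for Borel A ⊆ ℝ_+ define the transition kernel P(δ, A) = ∫_{ℝ²} 𝟙_A(c_δ(x)) · h*_δ(x) dx. Then for every fixed Borel set A ⊆ ℝ_+, the function δ ↦ P(δ, A) is continuous on ℝ_+ = (0,∞). -/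
open MeasureTheory

/-- Generalized dominated convergence: nonnegative integrable functions `g i` with a common integral
which converge pointwise may be multiplied by pointwise convergent weights in `[0, 1]`. -/
theorem tendsto_integral_mul_of_integral_eq {α ι : Type*} [MeasurableSpace α] {μ : Measure α}
    {l : Filter ι} [l.IsCountablyGenerated] {g k : ι → α → ℝ} {g₀ k₀ : α → ℝ}
    (hg : ∀ i, Integrable (g i) μ) (hg₀ : Integrable g₀ μ) (hgpos : ∀ i x, 0 ≤ g i x)
    (hg₀pos : ∀ x, 0 ≤ g₀ x) (hgint : ∀ i, ∫ x, g i x ∂μ = ∫ x, g₀ x ∂μ)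
    (hk : ∀ i, AEStronglyMeasurable (k i) μ) (hk0 : ∀ i x, 0 ≤ k i x) (hk1 : ∀ i x, k i x ≤ 1)
    (hk₀1 : ∀ x, k₀ x ≤ 1)
    (hglim : ∀ᵐ x ∂μ, Filter.Tendsto (fun i => g i x) l (nhds (g₀ x)))
    (hklim : ∀ᵐ x ∂μ, Filter.Tendsto (fun i => k i x) l (nhds (k₀ x))) :
    Filter.Tendsto (fun i => ∫ x, g i x * k i x ∂μ) l (nhds (∫ x, g₀ x * k₀ x ∂μ)) := by
  have hgk : ∀ i, Integrable (fun x => g i x * k i x) μ := fun i =>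
    (hg i).mono ((hg i).aestronglyMeasurable.mul (hk i)) (Filter.Eventually.of_forall fun x => by
      rw [Real.norm_of_nonneg (mul_nonneg (hgpos i x) (hk0 i x)), Real.norm_of_nonneg (hgpos i x)]
      exact mul_le_of_le_one_right (hgpos i x) (hk1 i x))
  have hmin : ∀ i, Integrable (fun x => min (g i x * k i x) (g₀ x)) μ := fun i => (hgk i).inf hg₀
  have hdefect : ∀ i, Integrable (fun x => max (g₀ x - g i x) 0) μ := fun i =>
    (hg₀.sub (hg i)).pos_part
  have hlim_min : Filter.Tendsto (fun i => ∫ x, min (g i x * k i x) (g₀ x) ∂μ) l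
      (nhds (∫ x, g₀ x * k₀ x ∂μ)) := by
    refine tendsto_integral_filter_of_dominated_convergence g₀
      (Filter.Eventually.of_forall fun i => (hmin i).aestronglyMeasurable)
      (Filter.Eventually.of_forall fun i => Filter.Eventually.of_forall fun x => ?_) hg₀ ?_
    · rw [Real.norm_of_nonneg (le_min (mul_nonneg (hgpos i x) (hk0 i x)) (hg₀pos x))]
      exact min_le_right _ _
    · filter_upwards [hglim, hklim] with x hx hx'
      have := (hx.mul hx').min (tendsto_const_nhds (x := g₀ x))
      rwa [min_eq_left (mul_le_of_le_one_right (hg₀pos x) (hk₀1 x))] at this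
  have hlim_defect : Filter.Tendsto (fun i => ∫ x, max (g₀ x - g i x) 0 ∂μ) l (nhds 0) := by
    have : Filter.Tendsto (fun i => ∫ x, max (g₀ x - g i x) 0 ∂μ) l (nhds (∫ _, (0 : ℝ) ∂μ)) := by
      refine tendsto_integral_filter_of_dominated_convergence g₀
        (Filter.Eventually.of_forall fun i => (hdefect i).aestronglyMeasurable)
        (Filter.Eventually.of_forall fun i => Filter.Eventually.of_forall fun x => ?_) hg₀ ?_
      · rw [Real.norm_of_nonneg (le_max_right _ _)]
        exact max_le (by linarith [hgpos i x]) (hg₀pos x)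
      · filter_upwards [hglim] with x hx
        have := ((tendsto_const_nhds (x := g₀ x)).sub hx).max (tendsto_const_nhds (x := (0 : ℝ)))
        simpa using this
    simpa using this
  refine tendsto_of_tendsto_of_tendsto_of_le_of_le hlim_min
    (by simpa using hlim_min.add hlim_defect) (fun i => ?_) (fun i => ?_)
  · exact integral_mono (hmin i) (hgk i) fun x => min_le_left _ _
  · have hdiff : ∫ x, (g i x - g₀ x) ∂μ = 0 := by
      rw [integral_sub (hg i) hg₀, hgint i, sub_self]
    have hsum : (∫ x, min (g i x * k i x) (g₀ x) ∂μ) + ∫ x, max (g₀ x - g i x) 0 ∂μ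
        = ∫ x, (min (g i x * k i x) (g₀ x) + (max (g₀ x - g i x) 0 + (g i x - g₀ x))) ∂μ := by
      rw [integral_add (hmin i) (by exact (hdefect i).add ((hg i).sub hg₀)),
        integral_add (hdefect i) (by exact (hg i).sub hg₀), hdiff, add_zero]
    change _ ≤ (∫ x, min (g i x * k i x) (g₀ x) ∂μ) + ∫ x, max (g₀ x - g i x) 0 ∂μ
    rw [hsum]
    refine integral_mono (hgk i) ((hmin i).add ((hdefect i).add ((hg i).sub hg₀))) fun x => ?_
    have h1 : g i x * k i x ≤ g i x := mul_le_of_le_one_right (hgpos i x) (hk1 i x)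
    change _ ≤ min (g i x * k i x) (g₀ x) + (max (g₀ x - g i x) 0 + (g i x - g₀ x))
    rcases min_cases (g i x * k i x) (g₀ x) with ⟨h2, -⟩ | ⟨h2, -⟩ <;>
      linarith [le_max_left (g₀ x - g i x) 0, le_max_right (g₀ x - g i x) 0]

/-- A strict inequality between distinct limits is eventually decided by the limits. -/
theorem eventually_lt_iff_of_tendsto {ι : Type*} {l : Filter ι} {f : ι → ℝ} {a b : ℝ}
    (hf : Filter.Tendsto f l (nhds b)) (hab : a ≠ b) : ∀ᶠ i in l, (a < f i ↔ a < b) := by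
  rcases hab.lt_or_gt with hlt | hgt
  · filter_upwards [hf.eventually_const_lt hlt] with i hi using iff_of_true hi hlt
  · filter_upwards [hf.eventually_lt_const hgt] with i hi using iff_of_false hi.not_gt hgt.not_gt

/-- Lines in the plane are Lebesgue null sets. -/
theorem ae_linear_combination_ne {n : ℝ × ℝ} (hn : n ≠ 0) (c : ℝ) :
    ∀ᵐ x : ℝ × ℝ, n.1 * x.1 + n.2 * x.2 ≠ c := by
  let L : ℝ × ℝ →ₗ[ℝ] ℝ := n.1 • LinearMap.fst ℝ ℝ ℝ + n.2 • LinearMap.snd ℝ ℝ ℝ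
  have hL : ∀ x, L x = n.1 * x.1 + n.2 * x.2 := fun x => by simp [L]
  have hpos : 0 < n.1 * n.1 + n.2 * n.2 := by
    by_contra! hle
    exact hn (Prod.ext (by change n.1 = 0; nlinarith [mul_self_nonneg n.1, mul_self_nonneg n.2])
      (by change n.2 = 0; nlinarith [mul_self_nonneg n.1, mul_self_nonneg n.2]))
  let S : AffineSubspace ℝ (ℝ × ℝ) := (AffineSubspace.mk' c ⊥).comap L.toAffineMap
  have hS : ∀ x, x ∈ S ↔ n.1 * x.1 + n.2 * x.2 = c := fun x => by
    simp [S, AffineSubspace.mem_comap, AffineSubspace.mem_mk', hL, sub_eq_zero]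
  have hne : S ≠ ⊤ := fun htop => by
    have h0 : (0 : ℝ × ℝ) ∈ S := htop ▸ AffineSubspace.mem_top ℝ _ _
    have h1 : n ∈ S := htop ▸ AffineSubspace.mem_top ℝ _ _
    rw [hS] at h0 h1
    simp only [Prod.fst_zero, Prod.snd_zero, mul_zero, add_zero] at h0
    linarith
  have hnull := Measure.addHaar_affineSubspace (volume : Measure (ℝ × ℝ)) S hne
  rw [ae_iff]
  convert hnull using 2
  ext x
  simp [hS]

/-- The one-step transition kernel
`P(δ,A) = ∫ 𝟙_A(δ − n^⊤x) h*_δ(x) dx` of the normalized-distance chain of the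
constant-step-size (1,λ) evolution strategy is, for every fixed Borel `A ⊆ (0,∞)`,
continuous in `δ` on `(0,∞)`. -/
theorem transition_kernel_continuous
    (lam : ℕ) (hlam : 2 ≤ lam)
    (n : ℝ × ℝ) (hn : n ≠ 0)
    (h : ℝ × ℝ → ℝ) (hh : Continuous h) (hpos : ∀ x, 0 < h x)
    (H : Measure (ℝ × ℝ)) [IsProbabilityMeasure H]
    (hH : H = volume.withDensity (fun x => ENNReal.ofReal (h x)))
    -- the selected-movement density h*_δ
    (hstar : ℝ → ℝ × ℝ → ℝ)
    (hhstar : ∀ δ x, hstar δ x =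
      (lam : ℝ) *
        (Set.indicator {y : ℝ × ℝ | n.1 * y.1 + n.2 * y.2 < δ} h x /
          (H {y : ℝ × ℝ | n.1 * y.1 + n.2 * y.2 < δ}).toReal) *
        ((H {y : ℝ × ℝ | n.1 * y.1 + n.2 * y.2 < δ ∧ y.1 < x.1}).toReal /
          (H {y : ℝ × ℝ | n.1 * y.1 + n.2 * y.2 < δ}).toReal) ^ (lam - 1))
    -- the transition probability kernel P(δ, A)
    (P : ℝ → Set ℝ → ℝ)
    (hP : ∀ δ A, P δ A =
      ∫ x : ℝ × ℝ,
        Set.indicator A (fun _ => (1 : ℝ)) (δ - (n.1 * x.1 + n.2 * x.2)) *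
          hstar δ x) :
    ∀ A : Set ℝ, A ⊆ Set.Ioi 0 → MeasurableSet A →
      ContinuousOn (fun δ => P δ A) (Set.Ioi 0) := by
  intro A _ hA δ₀ hδ₀
  refine ContinuousAt.continuousWithinAt ?_
  have hac : H ≪ volume := hH ▸ withDensity_absolutelyContinuous _ _
  have hmeas : ∀ δ, MeasurableSet {y : ℝ × ℝ | n.1 * y.1 + n.2 * y.2 < δ} := fun δ =>
    measurableSet_lt (by fun_prop) measurable_const
  have hmeas' : ∀ δ t, MeasurableSet {y : ℝ × ℝ | n.1 * y.1 + n.2 * y.2 < δ ∧ y.1 < t} :=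
    fun δ t => (hmeas δ).inter (measurableSet_lt measurable_fst measurable_const)
  have hhint : Integrable h := by
    refine ⟨hh.aestronglyMeasurable, ?_⟩
    rw [hasFiniteIntegral_iff_ofReal (Filter.Eventually.of_forall fun x => (hpos x).le)]
    have := measure_lt_top H Set.univ
    rwa [hH, withDensity_apply _ MeasurableSet.univ, Measure.restrict_univ] at this
  set G : ℝ → ℝ := fun δ => (H {y : ℝ × ℝ | n.1 * y.1 + n.2 * y.2 < δ}).toReal with hG
  set F : ℝ → ℝ → ℝ := fun δ t =>
    (H {y : ℝ × ℝ | n.1 * y.1 + n.2 * y.2 < δ ∧ y.1 < t}).toReal with hF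
  have hGcont : ContinuousAt G δ₀ := by
    refine (ENNReal.tendsto_toReal (measure_ne_top _ _)).comp ?_
    refine tendsto_measure_of_ae_tendsto_indicator_of_isFiniteMeasure _ (hmeas δ₀) hmeas ?_
    filter_upwards [hac.ae_le (ae_linear_combination_ne hn δ₀)] with y hy
    exact eventually_lt_iff_of_tendsto Filter.tendsto_id hy
  have hFcont : ∀ u : ℝ → ℝ, ContinuousAt u δ₀ →
      Filter.Tendsto (fun δ => F δ (u δ)) (nhds δ₀) (nhds (F δ₀ (u δ₀))) := by
    intro u hu
    refine (ENNReal.tendsto_toReal (measure_ne_top _ _)).comp ?_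
    refine tendsto_measure_of_ae_tendsto_indicator_of_isFiniteMeasure _ (hmeas' δ₀ _)
      (fun δ => hmeas' δ (u δ)) ?_
    have h10 : ((1, 0) : ℝ × ℝ) ≠ 0 := by simp
    filter_upwards [hac.ae_le (ae_linear_combination_ne hn δ₀),
      hac.ae_le (ae_linear_combination_ne h10 (u δ₀))] with y hy hy'
    simp only [one_mul, zero_mul, add_zero] at hy'
    filter_upwards [eventually_lt_iff_of_tendsto Filter.tendsto_id hy,
      eventually_lt_iff_of_tendsto hu hy'] with δ h1 h2
    exact and_congr h1 h2
  have hGpos : 0 < G δ₀ := by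
    refine ENNReal.toReal_pos (fun h0 => ?_) (measure_ne_top _ _)
    have hvol : volume {y : ℝ × ℝ | n.1 * y.1 + n.2 * y.2 < δ₀} = 0 := by
      rw [hH, withDensity_apply_eq_zero (by fun_prop)] at h0
      convert h0 using 2
      ext y
      simp [hpos y]
    exact ((isOpen_lt (by fun_prop) continuous_const).measure_pos volume
      ⟨0, by simpa using hδ₀⟩).ne' hvol
  have hFG : ∀ δ t, F δ t ≤ G δ := fun δ t =>
    ENNReal.toReal_mono (measure_ne_top _ _) (measure_mono fun y hy => hy.1)
  have hFmono : ∀ δ, Monotone (F δ) := fun δ s t hst =>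
    ENNReal.toReal_mono (measure_ne_top _ _) (measure_mono fun y hy => ⟨hy.1, hy.2.trans_le hst⟩)
  obtain ⟨m, hm⟩ : ∃ m : ℝ × ℝ, n.1 * m.1 + n.2 * m.2 = 1 := by
    by_cases h1 : n.1 = 0
    · have h2 : n.2 ≠ 0 := fun h2 => hn (Prod.ext h1 h2)
      exact ⟨(0, n.2⁻¹), by simp [h2]⟩
    · exact ⟨(n.1⁻¹, 0), by simp [h1]⟩
  let k : ℝ → ℝ × ℝ → ℝ := fun δ y =>
    Set.indicator {y : ℝ × ℝ | -(n.1 * y.1 + n.2 * y.2) ∈ A ∧ n.1 * y.1 + n.2 * y.2 < 0}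
      (fun _ => (1 : ℝ)) y * (F δ (y.1 + δ * m.1) / G δ) ^ (lam - 1)
  have hPk : ∀ δ, P δ A = (lam / G δ) * ∫ y, h (y + δ • m) * k δ y := by
    intro δ
    rw [hP, ← integral_add_right_eq_self _ (δ • m), ← integral_const_mul]
    refine integral_congr_ae (Filter.Eventually.of_forall fun y => ?_)
    have hlin : n.1 * (y + δ • m).1 + n.2 * (y + δ • m).2 = n.1 * y.1 + n.2 * y.2 + δ := by
      simp only [Prod.fst_add, Prod.snd_add, Prod.smul_fst, Prod.smul_snd, smul_eq_mul]
      linear_combination δ * hm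
    have hsub : δ - (n.1 * y.1 + n.2 * y.2 + δ) = -(n.1 * y.1 + n.2 * y.2) := by ring
    simp only [hhstar, k]
    rw [hlin, hsub]
    simp only [Set.indicator, Set.mem_ofPred_eq, hlin, add_lt_iff_neg_right]
    by_cases hyA : -(n.1 * y.1 + n.2 * y.2) ∈ A <;>
      by_cases hy0 : n.1 * y.1 + n.2 * y.2 < 0 <;>
      simp only [hyA, hy0, and_true, and_false, and_self, if_true, if_false, zero_mul, mul_zero,
        one_mul, zero_div]
    simp only [hF, hG, Prod.fst_add, Prod.smul_fst, smul_eq_mul]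
    ring
  have hratio0 : ∀ δ t, 0 ≤ F δ t / G δ := fun δ t =>
    div_nonneg ENNReal.toReal_nonneg ENNReal.toReal_nonneg
  have hratio1 : ∀ δ t, F δ t / G δ ≤ 1 := fun δ t =>
    div_le_one_of_le₀ (hFG δ t) ENNReal.toReal_nonneg
  have hk0 : ∀ δ y, 0 ≤ k δ y := fun δ y =>
    mul_nonneg (Set.indicator_nonneg (fun _ _ => zero_le_one) _) (pow_nonneg (hratio0 _ _) _)
  have hk1 : ∀ δ y, k δ y ≤ 1 := fun δ y =>
    mul_le_one₀ (Set.indicator_le_self' (fun _ _ => zero_le_one) _)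
      (pow_nonneg (hratio0 _ _) _) (pow_le_one₀ (hratio0 _ _) (hratio1 _ _))
  have hkmeas : ∀ δ, Measurable (k δ) := by
    intro δ
    have hset : MeasurableSet
        {y : ℝ × ℝ | -(n.1 * y.1 + n.2 * y.2) ∈ A ∧ n.1 * y.1 + n.2 * y.2 < 0} :=
      (hA.preimage (f := fun y : ℝ × ℝ => -(n.1 * y.1 + n.2 * y.2)) (by fun_prop)).inter (hmeas 0)
    have hFm : Measurable fun y : ℝ × ℝ => F δ (y.1 + δ * m.1) :=
      (hFmono δ).measurable.comp (by fun_prop)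
    exact (measurable_const.indicator hset).mul ((hFm.div_const _).pow_const _)
  have hlim : Filter.Tendsto (fun δ => ∫ y, h (y + δ • m) * k δ y) (nhds δ₀)
      (nhds (∫ y, h (y + δ₀ • m) * k δ₀ y)) := by
    refine tendsto_integral_mul_of_integral_eq (fun δ => hhint.comp_add_right _)
      (hhint.comp_add_right _) (fun _ _ => (hpos _).le) (fun _ => (hpos _).le)
      (fun δ => by rw [integral_add_right_eq_self h, integral_add_right_eq_self h])
      (fun δ => (hkmeas δ).aestronglyMeasurable) hk0 hk1 (hk1 _)
      (Filter.Eventually.of_forall fun y => ?_) (Filter.Eventually.of_forall fun y => ?_)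
    · exact (by fun_prop : Continuous fun δ : ℝ => h (y + δ • m)).tendsto δ₀
    · exact (((hFcont (fun δ => y.1 + δ * m.1) (by fun_prop)).div hGcont hGpos.ne').pow _).const_mul _
  change Filter.Tendsto (fun δ => P δ A) (nhds δ₀) (nhds (P δ₀ A))
  simp only [hPk]
  exact (tendsto_const_nhds.div hGcont hGpos.ne').mul hlim
end

section
/- Let λ ≥ 2, n ∈ ℝ² nonzero, H a law on ℝ² with continuous, strictly positive density h, and for δ > 0 let h*_δ(x) = λ·(h(x)𝟙_{L_δ}(x)/H(L_δ))·H_δ((−∞,[x]_1)×ℝ)^{λ−1}, c_δ(x) = δ − n^⊤x, and P(δ,A) = ∫_{ℝ²} 𝟙_A(c_δ(x)) h*_δ(x) dx for Borel A ⊆ ℝ_+. Then for every δ > 0 and every Borel set A ⊆ ℝ_+ with positive Lebesgue measure, P(δ, A) > 0. -/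
open MeasureTheory

/-- The preimage of a set of positive measure under a nonzero linear form on the plane has
positive measure. -/
lemma volume_preimage_linearForm_pos {n : ℝ × ℝ} (hn : n ≠ 0) {B : Set ℝ}
    (hB : MeasurableSet B) (hpos : 0 < volume B) :
    0 < volume ((fun x : ℝ × ℝ => n.1 * x.1 + n.2 * x.2) ⁻¹' B) := by
  let L : ℝ × ℝ →ₗ[ℝ] ℝ := n.1 • LinearMap.fst ℝ ℝ ℝ + n.2 • LinearMap.snd ℝ ℝ ℝ
  have hL : ∀ x, L x = n.1 * x.1 + n.2 * x.2 := fun x => by simp [L]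
  have hL0 : L ≠ 0 := fun h0 => hn <| by
    have h1 := hL (1, 0)
    have h2 := hL (0, 1)
    simp only [h0, LinearMap.zero_apply, mul_one, mul_zero, add_zero, zero_add] at h1 h2
    exact Prod.ext h1.symm h2.symm
  obtain ⟨c, hc, hmap⟩ := L.exists_map_addHaar_eq_smul_addHaar volume volume
    (LinearMap.surjective hL0)
  have hLm : Measurable L := L.continuous_of_finiteDimensional.measurable
  have hpre : (fun x : ℝ × ℝ => n.1 * x.1 + n.2 * x.2) ⁻¹' B = L ⁻¹' B := by
    ext x; simp [hL]
  rw [hpre, ← Measure.map_apply hLm hB, hmap, Measure.smul_apply, smul_eq_mul]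
  exact ENNReal.mul_pos hc.ne' hpos.ne'

/-- The one-step transition kernel
`P(δ,A) = ∫ 𝟙_A(δ − n^⊤x) h*_δ(x) dx` of the normalized-distance chain of the
constant-step-size (1,λ) evolution strategy charges every Borel set `A ⊆ (0,∞)`
of positive Lebesgue measure: `P(δ,A) > 0` for all `δ > 0`. -/
theorem transition_kernel_positive
    (lam : ℕ) (hlam : 2 ≤ lam)
    (n : ℝ × ℝ) (hn : n ≠ 0)
    (h : ℝ × ℝ → ℝ) (hh : Continuous h) (hpos : ∀ x, 0 < h x)
    (H : Measure (ℝ × ℝ)) [IsProbabilityMeasure H]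
    (hH : H = volume.withDensity (fun x => ENNReal.ofReal (h x)))
    -- the selected-movement density h*_δ
    (hstar : ℝ → ℝ × ℝ → ℝ)
    (hhstar : ∀ δ x, hstar δ x =
      (lam : ℝ) *
        (Set.indicator {y : ℝ × ℝ | n.1 * y.1 + n.2 * y.2 < δ} h x /
          (H {y : ℝ × ℝ | n.1 * y.1 + n.2 * y.2 < δ}).toReal) *
        ((H {y : ℝ × ℝ | n.1 * y.1 + n.2 * y.2 < δ ∧ y.1 < x.1}).toReal /
          (H {y : ℝ × ℝ | n.1 * y.1 + n.2 * y.2 < δ}).toReal) ^ (lam - 1))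
    -- the transition probability kernel P(δ, A)
    (P : ℝ → Set ℝ → ℝ)
    (hP : ∀ δ A, P δ A =
      ∫ x : ℝ × ℝ,
        Set.indicator A (fun _ => (1 : ℝ)) (δ - (n.1 * x.1 + n.2 * x.2)) *
          hstar δ x) :
    ∀ δ : ℝ, 0 < δ → ∀ A : Set ℝ, A ⊆ Set.Ioi 0 → MeasurableSet A →
      0 < volume A → 0 < P δ A := by
  intro δ hδ A hA hAm hApos
  have hlin : Continuous fun y : ℝ × ℝ => n.1 * y.1 + n.2 * y.2 := by fun_prop
  have hLopen : IsOpen {y : ℝ × ℝ | n.1 * y.1 + n.2 * y.2 < δ} :=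
    isOpen_lt hlin continuous_const
  have hHpos : ∀ U : Set (ℝ × ℝ), IsOpen U → U.Nonempty → 0 < (H U).toReal := by
    intro U hU hne
    refine ENNReal.toReal_pos (fun h0 => ?_) (measure_ne_top H U)
    rw [hH, withDensity_apply_eq_zero (by fun_prop)] at h0
    have huniv : {x | ENNReal.ofReal (h x) ≠ 0} = Set.univ := by
      ext x; simp [hpos x]
    rw [huniv, Set.univ_inter] at h0
    exact (hU.measure_pos volume hne).ne' h0
  have hhint : Integrable h := by
    refine ⟨hh.aestronglyMeasurable, ?_⟩
    rw [hasFiniteIntegral_iff_ofReal (Filter.Eventually.of_forall fun x => (hpos x).le),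
      ← setLIntegral_univ, ← withDensity_apply _ MeasurableSet.univ, ← hH]
    exact measure_lt_top H _
  set L : Set (ℝ × ℝ) := {y | n.1 * y.1 + n.2 * y.2 < δ} with hLdef
  have hZ : 0 < (H L).toReal := hHpos L hLopen ⟨0, by simpa [hLdef] using hδ⟩
  set F : ℝ → ℝ := fun t => (H {y | n.1 * y.1 + n.2 * y.2 < δ ∧ y.1 < t}).toReal with hF
  have hFmono : Monotone F := fun s t hst =>
    ENNReal.toReal_mono (measure_ne_top H _)
      (measure_mono fun y hy => ⟨hy.1, hy.2.trans_le hst⟩)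
  have hF0 : ∀ t, 0 ≤ F t := fun t => ENNReal.toReal_nonneg
  have hFle : ∀ t, F t ≤ (H L).toReal := fun t =>
    ENNReal.toReal_mono (measure_ne_top H _) (measure_mono fun y hy => hy.1)
  have hFpos : ∀ x ∈ L, 0 < F x.1 := by
    intro x hx
    refine hHpos _ (hLopen.inter (isOpen_lt continuous_fst continuous_const)) ?_
    have hev : ∀ᶠ t in nhdsWithin x.1 (Set.Iio x.1), (t, x.2) ∈ L := by
      refine Filter.Eventually.filter_mono nhdsWithin_le_nhds ?_
      exact (Continuous.prodMk_left x.2).continuousAt.eventually (hLopen.mem_nhds hx)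
    obtain ⟨t, ht, htx⟩ := (hev.and self_mem_nhdsWithin).exists
    exact ⟨(t, x.2), ht, htx⟩
  set G : ℝ × ℝ → ℝ := fun x => (F x.1 / (H L).toReal) ^ (lam - 1) with hG
  have hGm : Measurable G := ((hFmono.measurable.comp measurable_fst).div_const _).pow_const _
  have hlam0 : (0 : ℝ) < lam := by positivity
  have hstar_eq : ∀ x, hstar δ x = lam * (L.indicator h x / (H L).toReal) * G x := hhstar δ
  have hstar_nonneg : ∀ x, 0 ≤ hstar δ x := fun x => by
    rw [hstar_eq]
    have h1 : 0 ≤ L.indicator h x := Set.indicator_nonneg (fun y _ => (hpos y).le) x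
    have h2 : 0 ≤ G x := pow_nonneg (div_nonneg (hF0 _) hZ.le) _
    positivity
  have hstar_pos : ∀ x ∈ L, 0 < hstar δ x := fun x hx => by
    rw [hstar_eq, Set.indicator_of_mem hx]
    have h1 := hpos x
    have h2 : 0 < G x := pow_pos (div_pos (hFpos x hx) hZ) _
    positivity
  have hstar_int : Integrable (hstar δ) := by
    rw [funext hstar_eq]
    refine (((hhint.indicator hLopen.measurableSet).div_const _).const_mul _).mul_bdd (c := 1)
      hGm.aestronglyMeasurable (Filter.Eventually.of_forall fun x => ?_)
    have h1 : 0 ≤ F x.1 / (H L).toReal := div_nonneg (hF0 _) hZ.le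
    rw [Real.norm_of_nonneg (pow_nonneg h1 _)]
    exact pow_le_one₀ h1 ((div_le_one hZ).2 (hFle _))
  set S : Set (ℝ × ℝ) := {x | δ - (n.1 * x.1 + n.2 * x.2) ∈ A} with hS
  have hSm : MeasurableSet S := (continuous_const.sub hlin).measurable hAm
  have hSL : S ⊆ L := fun x hx => by
    have := hA hx
    exact sub_pos.1 (Set.mem_Ioi.1 this)
  have hSpos : 0 < volume S := by
    refine volume_preimage_linearForm_pos hn (B := (fun t => δ - t) ⁻¹' A)
      ((measurable_const.sub measurable_id) hAm) ?_
    rwa [(Measure.measurePreserving_sub_left volume δ).measure_preimage hAm.nullMeasurableSet]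
  have hint_eq : (fun x : ℝ × ℝ => A.indicator (fun _ => (1 : ℝ))
      (δ - (n.1 * x.1 + n.2 * x.2)) * hstar δ x) = S.indicator (hstar δ) := by
    ext x
    by_cases hx : δ - (n.1 * x.1 + n.2 * x.2) ∈ A
    · rw [Set.indicator_of_mem hx, Set.indicator_of_mem (s := S) hx, one_mul]
    · rw [Set.indicator_of_notMem hx, Set.indicator_of_notMem (s := S) hx, zero_mul]
  rw [hP, hint_eq, integral_pos_iff_support_of_nonneg
    (Set.indicator_nonneg fun x _ => hstar_nonneg x) (hstar_int.indicator hSm)]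
  refine hSpos.trans_le (measure_mono fun x hx => ?_)
  rw [Function.mem_support, Set.indicator_of_mem hx]
  exact (hstar_pos x (hSL hx)).ne'
end

section
/- (Sklar's theorem, bivariate case.) Let F₁ and F₂ be cumulative distribution functions of one-dimensional random variables. Then: (a) for every probability measure on ℝ² whose joint CDF F has marginals F₁ and F₂, there exists a two-dimensional copula C with F(x₁,x₂) = C(F₁(x₁), F₂(x₂)) for all (x₁,x₂) ∈ ℝ²; this C is uniquely determined on ran F₁ × ran F₂ and is given there by C(u₁,u₂) = F(F₁^−(u₁), F₂^−(u₂)), where F_i^−(y) = inf{ x ∈ ℝ : F_i(x) ≥ y }; (b) conversely, for every two-dimensional copula C, the function F(x₁,x₂) = C(F₁(x₁), F₂(x₂)) is the joint CDF of a probability measure on ℝ² with marginals F₁ and F₂. -/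
open MeasureTheory Set

/-- A two-dimensional copula: grounded, uniform margins, and 2-increasing on `[0,1]²`. -/
def IsCopula2 (C : ℝ → ℝ → ℝ) : Prop :=
  (∀ u ∈ Set.Icc (0 : ℝ) 1, C u 0 = 0 ∧ C 0 u = 0 ∧ C u 1 = u ∧ C 1 u = u) ∧
  (∀ a₁ b₁ a₂ b₂ : ℝ, a₁ ∈ Set.Icc (0 : ℝ) 1 → b₁ ∈ Set.Icc (0 : ℝ) 1 →
    a₂ ∈ Set.Icc (0 : ℝ) 1 → b₂ ∈ Set.Icc (0 : ℝ) 1 → a₁ ≤ b₁ → a₂ ≤ b₂ →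
    0 ≤ C b₁ b₂ - C a₁ b₂ - C b₁ a₂ + C a₁ a₂)

open Filter Topology ProbabilityTheory

namespace IsCopula2

variable {C : ℝ → ℝ → ℝ}

lemma sub_left_mem_Icc (hC : IsCopula2 C) {a b v : ℝ} (ha : a ∈ Icc (0 : ℝ) 1)
    (hb : b ∈ Icc (0 : ℝ) 1) (hv : v ∈ Icc (0 : ℝ) 1) (hab : a ≤ b) :
    C b v - C a v ∈ Icc 0 (b - a) := by
  have h0 := hC.2 a b 0 v ha hb (by simp) hv hab hv.1
  have h1 := hC.2 a b v 1 ha hb hv (by simp) hab hv.2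
  have hca := hC.1 a ha
  have hcb := hC.1 b hb
  constructor <;> linarith

lemma swap (hC : IsCopula2 C) : IsCopula2 (fun u v ↦ C v u) := by
  refine ⟨fun u hu ↦ ?_, fun a₁ b₁ a₂ b₂ ha₁ hb₁ ha₂ hb₂ h₁ h₂ ↦ ?_⟩
  · obtain ⟨h1, h2, h3, h4⟩ := hC.1 u hu
    exact ⟨h2, h1, h4, h3⟩
  · have := hC.2 a₂ b₂ a₁ b₁ ha₂ hb₂ ha₁ hb₁ h₂ h₁
    linarith

lemma abs_sub_left_le (hC : IsCopula2 C) {a b v : ℝ} (ha : a ∈ Icc (0 : ℝ) 1)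
    (hb : b ∈ Icc (0 : ℝ) 1) (hv : v ∈ Icc (0 : ℝ) 1) : |C b v - C a v| ≤ |b - a| := by
  rcases le_total a b with hab | hab
  · have h := hC.sub_left_mem_Icc ha hb hv hab
    rw [abs_of_nonneg h.1, abs_of_nonneg (sub_nonneg.2 hab)]
    exact h.2
  · have h := hC.sub_left_mem_Icc hb ha hv hab
    rw [abs_sub_comm, abs_sub_comm b, abs_of_nonneg h.1, abs_of_nonneg (sub_nonneg.2 hab)]
    exact h.2

lemma abs_sub_le (hC : IsCopula2 C) {a b c d : ℝ} (ha : a ∈ Icc (0 : ℝ) 1)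
    (hb : b ∈ Icc (0 : ℝ) 1) (hc : c ∈ Icc (0 : ℝ) 1) (hd : d ∈ Icc (0 : ℝ) 1) :
    |C b d - C a c| ≤ |b - a| + |d - c| := by
  have h1 := hC.abs_sub_left_le ha hb hd
  have h2 := hC.swap.abs_sub_left_le hc hd ha
  calc |C b d - C a c| = |(C b d - C a d) + (C a d - C a c)| := by ring_nf
    _ ≤ _ := (abs_add_le _ _).trans (add_le_add h1 h2)

lemma continuousOn (hC : IsCopula2 C) :
    ContinuousOn (fun p : ℝ × ℝ ↦ C p.1 p.2) (Icc 0 1 ×ˢ Icc 0 1) := by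
  rintro ⟨a, c⟩ ⟨ha, hc⟩
  rw [ContinuousWithinAt, tendsto_iff_dist_tendsto_zero]
  have hlim : Tendsto (fun p : ℝ × ℝ ↦ |p.1 - a| + |p.2 - c|)
      (𝓝[Icc 0 1 ×ˢ Icc 0 1] (a, c)) (𝓝 0) := by
    have : Continuous fun p : ℝ × ℝ ↦ |p.1 - a| + |p.2 - c| := by fun_prop
    simpa using (this.tendsto (a, c)).mono_left nhdsWithin_le_nhds
  refine squeeze_zero' (Eventually.of_forall fun _ ↦ dist_nonneg) ?_ hlim
  filter_upwards [self_mem_nhdsWithin] with p hp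
  exact hC.abs_sub_le ha hp.1 hc hp.2

end IsCopula2

lemma sum_range_sum_range_rectangle_increments (G : ℕ → ℕ → ℝ) (k l : ℕ) :
    ∑ i ∈ Finset.range k, ∑ j ∈ Finset.range l,
      (G (i + 1) (j + 1) - G i (j + 1) - G (i + 1) j + G i j)
      = G k l - G 0 l - G k 0 + G 0 0 := by
  have inner (i : ℕ) : ∑ j ∈ Finset.range l,
      (G (i + 1) (j + 1) - G i (j + 1) - G (i + 1) j + G i j)
      = G (i + 1) l - G i l - G (i + 1) 0 + G i 0 := by
    induction l with
    | zero => simp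
    | succ l ih => rw [Finset.sum_range_succ, ih]; ring
  simp_rw [inner]
  induction k with
  | zero => simp
  | succ k ih => rw [Finset.sum_range_succ, ih]; ring

/-- The largest multiple of `1 / n` in `[0, 1]` that is at most `a`, and `0` for negative `a`. -/
noncomputable def gridFloor (n : ℕ) (a : ℝ) : ℝ := (min n ⌊n * a⌋₊ : ℕ) / n

lemma gridFloor_mem_Icc (n : ℕ) (a : ℝ) : gridFloor n a ∈ Icc (0 : ℝ) 1 := by
  refine ⟨by unfold gridFloor; positivity, div_le_one_of_le₀ ?_ (by positivity)⟩
  exact_mod_cast min_le_left _ _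

lemma tendsto_gridFloor (a : ℝ) :
    Tendsto (fun n ↦ gridFloor n a) atTop (𝓝 (max 0 (min 1 a))) := by
  rcases le_or_gt a 0 with ha | ha
  · have h (n : ℕ) : gridFloor n a = 0 := by
      have : ⌊n * a⌋₊ = 0 := Nat.floor_of_nonpos (mul_nonpos_of_nonneg_of_nonpos (by simp) ha)
      simp [gridFloor, this]
    simp [h, min_eq_right (ha.trans zero_le_one), ha]
  · have h1 : Tendsto (fun n : ℕ ↦ (⌊n * a⌋₊ : ℝ) / n) atTop (𝓝 a) := by
      have := (tendsto_nat_floor_mul_div_atTop ha.le).comp (tendsto_natCast_atTop_atTop (R := ℝ))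
      simpa [Function.comp_def, mul_comm] using this
    rw [max_eq_right (le_min zero_le_one ha.le)]
    refine (tendsto_const_nhds.min h1).congr' ?_
    filter_upwards [eventually_gt_atTop 0] with n hn
    have hn' : (0 : ℝ) < n := by exact_mod_cast hn
    rw [gridFloor, Nat.cast_min, ← min_div_div_right hn'.le, div_self hn'.ne']

lemma exists_discrete_measure_of_isCopula2 {C : ℝ → ℝ → ℝ} (hC : IsCopula2 C) {n : ℕ}
    (hn : 0 < n) :
    ∃ π : Measure (ℝ × ℝ), IsProbabilityMeasure π ∧ π (Icc 0 1)ᶜ = 0 ∧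
      ∀ a b, π (Iic (a, b)) = ENNReal.ofReal (C (gridFloor n a) (gridFloor n b)) := by
  have hn' : (0 : ℝ) < n := by exact_mod_cast hn
  set G : ℕ → ℕ → ℝ := fun i j ↦ C (i / n) (j / n) with hG
  set w : ℕ → ℕ → ℝ := fun i j ↦ G (i + 1) (j + 1) - G i (j + 1) - G (i + 1) j + G i j
  have mem {i : ℕ} (hi : i ≤ n) : (i / n : ℝ) ∈ Icc (0 : ℝ) 1 :=
    ⟨by positivity, div_le_one_of_le₀ (by exact_mod_cast hi) hn'.le⟩
  have w_nonneg {i j : ℕ} (hi : i < n) (hj : j < n) : 0 ≤ w i j := by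
    refine hC.2 _ _ _ _ (mem hi.le) (mem hi) (mem hj.le) (mem hj) ?_ ?_ <;>
    · gcongr
      simp
  set pt : ℕ → ℕ → ℝ × ℝ := fun i j ↦ (((i + 1 : ℕ) : ℝ) / n, ((j + 1 : ℕ) : ℝ) / n) with hpt
  set π : Measure (ℝ × ℝ) := ∑ i ∈ Finset.range n, ∑ j ∈ Finset.range n,
    ENNReal.ofReal (w i j) • Measure.dirac (pt i j) with hπ
  have apply_eq (S : Set (ℝ × ℝ)) (hS : MeasurableSet S) : π S =
      ∑ i ∈ Finset.range n, ∑ j ∈ Finset.range n,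
        ENNReal.ofReal (w i j) * S.indicator 1 (pt i j) := by
    simp [hπ, Measure.finsetSum_apply, hS]
  have le_iff (i : ℕ) (a : ℝ) : ((i + 1 : ℕ) : ℝ) / n ≤ a ↔ i < ⌊n * a⌋₊ := by
    rw [div_le_iff₀' hn', ← Nat.le_floor_iff' (by simp), Nat.succ_le_iff]
  have cdf_eq (a b : ℝ) :
      π (Iic (a, b)) = ENNReal.ofReal (C (gridFloor n a) (gridFloor n b)) := by
    have filter_eq (k : ℕ) : {i ∈ Finset.range n | i < k} = Finset.range (min n k) := by
      ext; simp
    have h1 : π (Iic (a, b)) = ∑ i ∈ Finset.range (min n ⌊n * a⌋₊),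
        ∑ j ∈ Finset.range (min n ⌊n * b⌋₊), ENNReal.ofReal (w i j) := by
      rw [apply_eq _ measurableSet_Iic, ← filter_eq, Finset.sum_filter]
      refine Finset.sum_congr rfl fun i _ ↦ ?_
      rw [← filter_eq, Finset.sum_filter]
      split_ifs with hi
      · refine Finset.sum_congr rfl fun j _ ↦ ?_
        simp [indicator_apply, hpt, Prod.le_def, -Nat.cast_add, le_iff, hi]
      · refine Finset.sum_eq_zero fun j _ ↦ ?_
        simp [hpt, Prod.le_def, -Nat.cast_add, le_iff, hi]
    have w_nonneg' : ∀ i ∈ Finset.range (min n ⌊n * a⌋₊), ∀ j ∈ Finset.range (min n ⌊n * b⌋₊),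
        0 ≤ w i j := fun i hi j hj ↦
      w_nonneg (by simp at hi; exact hi.1) (by simp at hj; exact hj.1)
    rw [h1, Finset.sum_congr rfl fun i hi ↦ (ENNReal.ofReal_sum_of_nonneg (w_nonneg' i hi)).symm,
      ← ENNReal.ofReal_sum_of_nonneg fun i hi ↦ Finset.sum_nonneg (w_nonneg' i hi),
      sum_range_sum_range_rectangle_increments]
    have ha := hC.1 _ (gridFloor_mem_Icc n a)
    have hb := hC.1 _ (gridFloor_mem_Icc n b)
    have h0 := hC.1 0 (by simp)
    simp only [gridFloor] at ha hb
    simp [hG, ha, hb, h0, gridFloor, -Nat.cast_min]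
  have pt_mem {i j : ℕ} (hi : i < n) (hj : j < n) : pt i j ∈ Icc (0 : ℝ × ℝ) 1 :=
    ⟨⟨(mem hi).1, (mem hj).1⟩, ⟨(mem hi).2, (mem hj).2⟩⟩
  have compl_eq : π (Icc 0 1)ᶜ = 0 := by
    rw [apply_eq _ measurableSet_Icc.compl]
    refine Finset.sum_eq_zero fun i hi ↦ Finset.sum_eq_zero fun j hj ↦ ?_
    rw [indicator_of_notMem (by simpa using pt_mem (by simpa using hi) (by simpa using hj)),
      mul_zero]
  have grid_one : gridFloor n 1 = 1 := by simp [gridFloor, hn'.ne']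
  refine ⟨π, ⟨?_⟩, compl_eq, cdf_eq⟩
  have h1 : π (Iic 1)ᶜ = 0 :=
    measure_mono_null (compl_subset_compl.2 Icc_subset_Iic_self) compl_eq
  have h2 := cdf_eq 1 1
  rw [grid_one, (hC.1 1 (by simp)).2.2.1, ENNReal.ofReal_one] at h2
  rw [← measure_add_measure_compl (measurableSet_Iic (a := (1 : ℝ × ℝ))), h1, add_zero]
  exact h2

lemma IsCopula2.exists_measure {C : ℝ → ℝ → ℝ} (hC : IsCopula2 C) :
    ∃ π : Measure (ℝ × ℝ), IsProbabilityMeasure π ∧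
      ∀ a b, π (Iic (a, b)) = ENNReal.ofReal (C (max 0 (min 1 a)) (max 0 (min 1 b))) := by
  set D : ℝ → ℝ → ℝ := fun a b ↦ C (max 0 (min 1 a)) (max 0 (min 1 b)) with hD
  have clamp_mem (a : ℝ) : max 0 (min 1 a) ∈ Icc (0 : ℝ) 1 :=
    ⟨le_max_left _ _, max_le zero_le_one (min_le_left _ _)⟩
  choose ρ hρ_prob hρ_compl hρ using fun n : ℕ ↦ exists_discrete_measure_of_isCopula2 hC n.succ_pos
  have hlim (a b : ℝ) : Tendsto (fun n ↦ ρ n (Iic (a, b))) (hyperfilter ℕ)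
      (𝓝 (ENNReal.ofReal (D a b))) := by
    simp_rw [hρ]
    refine ENNReal.tendsto_ofReal ?_
    have h1 : Tendsto (fun n ↦ (gridFloor n a, gridFloor n b)) atTop
        (𝓝[Icc 0 1 ×ˢ Icc 0 1] (max 0 (min 1 a), max 0 (min 1 b))) :=
      tendsto_nhdsWithin_iff.2 ⟨(tendsto_gridFloor a).prodMk_nhds (tendsto_gridFloor b),
        Eventually.of_forall fun n ↦ ⟨gridFloor_mem_Icc n a, gridFloor_mem_Icc n b⟩⟩
    have h2 := (hC.continuousOn _ ⟨clamp_mem a, clamp_mem b⟩).tendsto.comp h1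
    exact (h2.comp (tendsto_add_atTop_nat 1)).mono_left Nat.hyperfilter_le_atTop
  set μs : ℕ → ProbabilityMeasure (ℝ × ℝ) := fun n ↦ ⟨ρ n, hρ_prob n⟩ with hμs
  obtain ⟨π, -, hπ⟩ : ∃ π ∈ {μ : ProbabilityMeasure (ℝ × ℝ) | ∀ _ : ℕ, μ (Icc 0 1)ᶜ ≤ 0},
      Tendsto μs (hyperfilter ℕ) (𝓝 π) := by
    refine (isCompact_setOfPred_probabilityMeasure_mass_eq_compl_isCompact_le
      (u := fun _ ↦ 0) tendsto_const_nhds (fun _ ↦ isCompact_Icc)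
      (Or.inl inferInstance)).ultrafilter_le_nhds' ((hyperfilter ℕ).map μs) ?_
    refine Ultrafilter.mem_map.2 (univ_mem' fun n _ ↦ ?_)
    simp [hμs, hρ_compl]
  refine ⟨π, inferInstance, fun a b ↦ le_antisymm ?_ ?_⟩
  · have h_le (ε : ℝ) (hε : 0 < ε) :
        (π : Measure (ℝ × ℝ)) (Iic (a, b)) ≤ ENNReal.ofReal (D (a + ε) (b + ε)) := by
      calc (π : Measure (ℝ × ℝ)) (Iic (a, b))
          ≤ (π : Measure (ℝ × ℝ)) (Iio (a + ε) ×ˢ Iio (b + ε)) := by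
            refine measure_mono fun p hp ↦ ⟨?_, ?_⟩
            · exact hp.1.trans_lt (lt_add_of_pos_right a hε)
            · exact hp.2.trans_lt (lt_add_of_pos_right b hε)
        _ ≤ liminf (fun n ↦ ρ n (Iio (a + ε) ×ˢ Iio (b + ε))) (hyperfilter ℕ) :=
            ProbabilityMeasure.le_liminf_measure_open_of_tendsto hπ (isOpen_Iio.prod isOpen_Iio)
        _ ≤ liminf (fun n ↦ ρ n (Iic (a + ε, b + ε))) (hyperfilter ℕ) := by
            refine liminf_le_liminf (Eventually.of_forall fun n ↦ measure_mono fun p hp ↦ ?_)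
            exact ⟨(mem_Iio.1 hp.1).le, (mem_Iio.1 hp.2).le⟩
        _ = ENNReal.ofReal (D (a + ε) (b + ε)) := (hlim _ _).liminf_eq
    have h_cont : Continuous fun ε : ℝ ↦ D (a + ε) (b + ε) :=
      hC.continuousOn.comp_continuous
        (f := fun ε : ℝ ↦ (max 0 (min 1 (a + ε)), max 0 (min 1 (b + ε))))
        (by fun_prop) fun ε ↦ ⟨clamp_mem _, clamp_mem _⟩
    have h_tendsto := (ENNReal.continuous_ofReal.comp h_cont).tendsto 0
    simp only [Function.comp_def, add_zero] at h_tendsto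
    refine ge_of_tendsto (h_tendsto.mono_left (nhdsWithin_le_nhds (s := Ioi 0))) ?_
    filter_upwards [self_mem_nhdsWithin] with ε hε using h_le ε hε
  · rw [← (hlim a b).limsup_eq]
    exact ProbabilityMeasure.limsup_measure_closed_le_of_tendsto hπ isClosed_Iic

section Quantile

variable (ν : Measure ℝ) {u : ℝ}

lemma sInf_setOf_le_cdf_le_iff (hu : 0 < u) (hne : ∃ z, u ≤ cdf ν z) (x : ℝ) :
    sInf {y | u ≤ cdf ν y} ≤ x ↔ u ≤ cdf ν x := by
  have hbdd : BddBelow {y | u ≤ cdf ν y} := by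
    obtain ⟨m, hm⟩ := ((tendsto_cdf_atBot ν).eventually_lt_const hu).exists
    exact ⟨m, fun y hy ↦ le_of_not_gt fun h ↦
      absurd (hy.trans (monotone_cdf ν h.le)) (not_le.2 hm)⟩
  refine ⟨fun h ↦ ?_, fun h ↦ csInf_le hbdd h⟩
  have hlim : Tendsto (cdf ν) (𝓝[>] x) (𝓝 (cdf ν x)) :=
    ((cdf ν).right_continuous x).tendsto.mono_left (nhdsWithin_mono _ Ioi_subset_Ici_self)
  refine ge_of_tendsto hlim ?_
  filter_upwards [self_mem_nhdsWithin] with y hy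
  obtain ⟨z, hz, hzy⟩ := exists_lt_of_csInf_lt hne (h.trans_lt hy)
  exact le_trans hz (monotone_cdf ν hzy.le)

lemma exists_le_cdf (hu : u < 1) : ∃ z, u ≤ cdf ν z :=
  (((tendsto_cdf_atTop ν).eventually_const_lt hu).exists).imp fun _ h ↦ h.le

/-- The generalized inverse of the distribution function of `ν` on `(0, 1)`, and `0` elsewhere. -/
noncomputable def quantile (u : ℝ) : ℝ :=
  open Classical in if u ∈ Ioo 0 1 then sInf {y | u ≤ cdf ν y} else 0

lemma quantile_le_iff (hu : u ∈ Ioo 0 1) (x : ℝ) : quantile ν u ≤ x ↔ u ≤ cdf ν x := by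
  rw [quantile, if_pos hu, sInf_setOf_le_cdf_le_iff ν hu.1 (exists_le_cdf ν hu.2)]

lemma measurable_quantile : Measurable (quantile ν) := by
  refine measurable_of_Iic fun x ↦ ?_
  have : quantile ν ⁻¹' Iic x = (Ioo 0 1 ∩ Iic (cdf ν x)) ∪ ((Ioo 0 1)ᶜ ∩ {_u | 0 ≤ x}) := by
    ext u
    by_cases hu : u ∈ Ioo (0 : ℝ) 1
    · simp only [mem_preimage, mem_Iic, quantile_le_iff ν hu, mem_union, mem_inter_iff, hu,
        mem_compl_iff, true_and, not_true_eq_false, false_and, or_false]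
    · simp only [mem_preimage, mem_Iic, quantile, mem_union, mem_inter_iff, hu, if_false,
        mem_compl_iff, not_false_eq_true, true_and, false_and, false_or, mem_ofPred_eq]
  rw [this]
  exact (measurableSet_Ioo.inter measurableSet_Iic).union
    (measurableSet_Ioo.compl.inter (MeasurableSet.const _))

end Quantile

lemma IsCopula2.exists_measure_of_marginals {C : ℝ → ℝ → ℝ} (hC : IsCopula2 C)
    (ν₁ ν₂ : Measure ℝ) [IsProbabilityMeasure ν₁] [IsProbabilityMeasure ν₂] :
    ∃ μ : Measure (ℝ × ℝ), IsProbabilityMeasure μ ∧ μ.map Prod.fst = ν₁ ∧ μ.map Prod.snd = ν₂ ∧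
      ∀ x₁ x₂, μ (Iic (x₁, x₂)) = ENNReal.ofReal (C (cdf ν₁ x₁) (cdf ν₂ x₂)) := by
  obtain ⟨π, hπ_prob, hπ⟩ := hC.exists_measure
  have full : ∀ᵐ p ∂π, p.1 ≤ 1 ∧ p.2 ≤ 1 := by
    have : π (Iic (1, 1)) = 1 := by rw [hπ]; simp [(hC.1 1 (by simp)).2.2.1]
    exact (prob_compl_eq_zero_iff measurableSet_Iic).2 this
  have fst_le {a : ℝ} (ha : a ∈ Icc (0 : ℝ) 1) : π {p | p.1 ≤ a} = ENNReal.ofReal a := by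
    have : π {p | p.1 ≤ a} = π (Iic (a, 1)) := by
      refine measure_congr ?_
      filter_upwards [full] with p hp
      exact propext ⟨fun h ↦ ⟨h, hp.2⟩, fun h ↦ h.1⟩
    rw [this, hπ]
    simp [ha.1, ha.2, (hC.1 a ha).2.2.1]
  have snd_le {a : ℝ} (ha : a ∈ Icc (0 : ℝ) 1) : π {p | p.2 ≤ a} = ENNReal.ofReal a := by
    have : π {p | p.2 ≤ a} = π (Iic (1, a)) := by
      refine measure_congr ?_
      filter_upwards [full] with p hp
      exact propext ⟨fun h ↦ ⟨hp.1, h⟩, fun h ↦ h.2⟩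
    rw [this, hπ]
    simp [ha.1, ha.2, (hC.1 a ha).2.2.2]
  have ae_mem_Ioo {f : ℝ × ℝ → ℝ} (hf : Measurable f)
      (h : ∀ a ∈ Icc (0 : ℝ) 1, π {p | f p ≤ a} = ENNReal.ofReal a) :
      ∀ᵐ p ∂π, f p ∈ Ioo (0 : ℝ) 1 := by
    have h0 : ∀ᵐ p ∂π, 0 < f p := by
      rw [ae_iff]
      simpa using h 0 (by simp)
    have h1 : ∀ᵐ p ∂π, f p < 1 := by
      rw [ae_iff]
      simp only [not_lt]
      have (a : ℝ) (ha : a ∈ Ico (0 : ℝ) 1) : π {p | 1 ≤ f p} ≤ ENNReal.ofReal (1 - a) := by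
        calc π {p | 1 ≤ f p} ≤ π {p | f p ≤ a}ᶜ :=
              measure_mono fun p hp ↦ not_le.2 (ha.2.trans_le hp)
          _ = ENNReal.ofReal (1 - a) := by
              rw [prob_compl_eq_one_sub (measurableSet_le hf measurable_const),
                h a ⟨ha.1, ha.2.le⟩, ENNReal.ofReal_sub _ ha.1, ENNReal.ofReal_one]
      have hlim : Tendsto (fun a : ℝ ↦ ENNReal.ofReal (1 - a)) (𝓝[<] 1) (𝓝 0) := by
        have : Continuous fun a : ℝ ↦ ENNReal.ofReal (1 - a) :=
          ENNReal.continuous_ofReal.comp (by fun_prop)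
        simpa using (this.tendsto 1).mono_left (nhdsWithin_le_nhds (s := Iio 1))
      refine le_antisymm (ge_of_tendsto hlim ?_) bot_le
      filter_upwards [Ico_mem_nhdsLT (zero_lt_one' ℝ)] with a ha using this a ha
    filter_upwards [h0, h1] with p hp0 hp1 using ⟨hp0, hp1⟩
  have hfst := ae_mem_Ioo measurable_fst fun _ ↦ fst_le
  have hsnd := ae_mem_Ioo measurable_snd fun _ ↦ snd_le
  have hT : Measurable (Prod.map (quantile ν₁) (quantile ν₂)) :=
    (measurable_quantile ν₁).prodMap (measurable_quantile ν₂)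
  have cdf_mem (ν : Measure ℝ) (x : ℝ) : cdf ν x ∈ Icc (0 : ℝ) 1 :=
    ⟨cdf_nonneg ν x, cdf_le_one ν x⟩
  have hprob : IsProbabilityMeasure (π.map (Prod.map (quantile ν₁) (quantile ν₂))) :=
    Measure.isProbabilityMeasure_map hT.aemeasurable
  refine ⟨π.map (Prod.map (quantile ν₁) (quantile ν₂)), hprob, ?_, ?_, fun x₁ x₂ ↦ ?_⟩
  · rw [Measure.map_map measurable_fst hT]
    refine (Measure.ext_of_Iic _ _ fun x ↦ ?_).symm
    rw [Measure.map_apply (measurable_fst.comp hT) measurableSet_Iic, ← ofReal_cdf ν₁,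
      ← fst_le (cdf_mem ν₁ x)]
    refine measure_congr ?_
    filter_upwards [hfst] with p hp
    exact propext (quantile_le_iff ν₁ hp x).symm
  · rw [Measure.map_map measurable_snd hT]
    refine (Measure.ext_of_Iic _ _ fun x ↦ ?_).symm
    rw [Measure.map_apply (measurable_snd.comp hT) measurableSet_Iic, ← ofReal_cdf ν₂,
      ← snd_le (cdf_mem ν₂ x)]
    refine measure_congr ?_
    filter_upwards [hsnd] with p hp
    exact propext (quantile_le_iff ν₂ hp x).symm
  · have h := hπ (cdf ν₁ x₁) (cdf ν₂ x₂)
    simp only [min_eq_right (cdf_le_one _ _), max_eq_right (cdf_nonneg _ _)] at h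
    rw [Measure.map_apply hT measurableSet_Iic, ← h]
    refine measure_congr ?_
    filter_upwards [hfst, hsnd] with p hp₁ hp₂
    exact propext (and_congr (quantile_le_iff ν₁ hp₁ x₁) (quantile_le_iff ν₂ hp₂ x₂))

section InterpIndicator

variable (ν : Measure ℝ) {u v : ℝ}

/-- The indicator of `Iio q` plus a multiple of the indicator of `{q}`, where `q` is the
`u`-quantile of `ν`, with the multiple chosen so that the integral against `ν` is `u`. -/
noncomputable def interpIndicator (u x : ℝ) : ℝ :=
  if u ≤ 0 then 0 else if 1 ≤ u then 1 else
    (Iio (quantile ν u)).indicator 1 x +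
      (u - ν.real (Iio (quantile ν u))) / ν.real {quantile ν u} *
        ({quantile ν u} : Set ℝ).indicator 1 x

lemma interpIndicator_of_nonpos (hu : u ≤ 0) (x : ℝ) : interpIndicator ν u x = 0 := if_pos hu

lemma interpIndicator_of_one_le (hu : 1 ≤ u) (x : ℝ) : interpIndicator ν u x = 1 := by
  rw [interpIndicator, if_neg (by linarith), if_pos hu]

lemma interpIndicator_of_mem_Ioo (hu : u ∈ Ioo 0 1) (x : ℝ) :
    interpIndicator ν u x = (Iio (quantile ν u)).indicator 1 x +
      (u - ν.real (Iio (quantile ν u))) / ν.real {quantile ν u} *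
        ({quantile ν u} : Set ℝ).indicator 1 x := by
  rw [interpIndicator, if_neg (not_le.2 hu.1), if_neg (not_le.2 hu.2)]

lemma measurable_interpIndicator : Measurable (interpIndicator ν u) := by
  unfold interpIndicator
  split_ifs
  · exact measurable_const
  · exact measurable_const
  · exact (measurable_one.indicator measurableSet_Iio).add
      ((measurable_one.indicator (measurableSet_singleton _)).const_mul _)

variable [IsProbabilityMeasure ν]

lemma measureReal_Iio_quantile_le (hu : u ∈ Ioo 0 1) : ν.real (Iio (quantile ν u)) ≤ u := by
  have h1 : ν (Iio (quantile ν u)) =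
      ENNReal.ofReal (Function.leftLim (cdf ν) (quantile ν u) - 0) := by
    have := (cdf ν).measure_Iio (tendsto_cdf_atBot ν) (quantile ν u)
    rwa [measure_cdf] at this
  rw [Measure.real, h1, sub_zero]
  refine ENNReal.toReal_le_of_le_ofReal hu.1.le (ENNReal.ofReal_le_ofReal ?_)
  refine le_of_tendsto ((monotone_cdf ν).tendsto_leftLim (quantile ν u)) ?_
  filter_upwards [self_mem_nhdsWithin] with z hz
  exact (lt_of_not_ge fun h ↦ absurd ((quantile_le_iff ν hu z).2 h) (not_le.2 hz)).le

lemma le_measureReal_Iio_add_singleton_quantile (hu : u ∈ Ioo 0 1) :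
    u ≤ ν.real (Iio (quantile ν u)) + ν.real {quantile ν u} := by
  rw [← measureReal_union (by simp) (measurableSet_singleton _), Iio_union_right,
    ← cdf_eq_real]
  exact (quantile_le_iff ν hu _).1 le_rfl

lemma interpIndicator_weight_mem_Icc (hu : u ∈ Ioo 0 1) :
    (u - ν.real (Iio (quantile ν u))) / ν.real {quantile ν u} ∈ Icc (0 : ℝ) 1 := by
  have h1 := measureReal_Iio_quantile_le ν hu
  have h2 := le_measureReal_Iio_add_singleton_quantile ν hu
  exact ⟨div_nonneg (by linarith) measureReal_nonneg,
    div_le_one_of_le₀ (by linarith) measureReal_nonneg⟩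

lemma indicator_Iio_le_interpIndicator (hu : u ∈ Ioo 0 1) (x : ℝ) :
    (Iio (quantile ν u)).indicator 1 x ≤ interpIndicator ν u x := by
  rw [interpIndicator_of_mem_Ioo ν hu]
  exact le_add_of_nonneg_right (mul_nonneg (interpIndicator_weight_mem_Icc ν hu).1
    (indicator_nonneg (by simp) x))

lemma interpIndicator_le_indicator_Iic (hu : u ∈ Ioo 0 1) (x : ℝ) :
    interpIndicator ν u x ≤ (Iic (quantile ν u)).indicator 1 x := by
  rw [interpIndicator_of_mem_Ioo ν hu]
  have h := (interpIndicator_weight_mem_Icc ν hu).2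
  rcases lt_trichotomy x (quantile ν u) with hx | hx | hx
  · simp [hx, hx.le, hx.ne]
  · simpa [hx] using h
  · simp [hx, hx.ne', hx.le]

lemma interpIndicator_mem_Icc (u x : ℝ) : interpIndicator ν u x ∈ Icc (0 : ℝ) 1 := by
  rcases le_or_gt u 0 with h0 | h0
  · simp [interpIndicator_of_nonpos ν h0]
  rcases le_or_gt 1 u with h1 | h1
  · simp [interpIndicator_of_one_le ν h1]
  refine ⟨(indicator_nonneg (by simp) x).trans (indicator_Iio_le_interpIndicator ν ⟨h0, h1⟩ x),
    (interpIndicator_le_indicator_Iic ν ⟨h0, h1⟩ x).trans ?_⟩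
  exact indicator_le_self' (by simp) x

lemma interpIndicator_mono (huv : u ≤ v) (x : ℝ) :
    interpIndicator ν u x ≤ interpIndicator ν v x := by
  rcases le_or_gt u 0 with hu | hu
  · rw [interpIndicator_of_nonpos ν hu]
    exact (interpIndicator_mem_Icc ν v x).1
  rcases le_or_gt 1 v with hv | hv
  · rw [interpIndicator_of_one_le ν hv]
    exact (interpIndicator_mem_Icc ν u x).2
  have hu' : u ∈ Ioo 0 1 := ⟨hu, huv.trans_lt hv⟩
  have hv' : v ∈ Ioo 0 1 := ⟨hu.trans_le huv, hv⟩
  have hq : quantile ν u ≤ quantile ν v :=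
    (quantile_le_iff ν hu' _).2 (huv.trans ((quantile_le_iff ν hv' _).1 le_rfl))
  rcases hq.eq_or_lt with hq | hq
  · rw [interpIndicator_of_mem_Ioo ν hu', interpIndicator_of_mem_Ioo ν hv', hq]
    gcongr
    exact indicator_nonneg (by simp) x
  · refine (interpIndicator_le_indicator_Iic ν hu' x).trans
      (le_trans ?_ (indicator_Iio_le_interpIndicator ν hv' x))
    exact indicator_le_indicator_of_subset (Iic_subset_Iio.2 hq) (by simp) x

lemma integrable_interpIndicator : Integrable (interpIndicator ν u) ν :=
  Integrable.of_mem_Icc 0 1 (measurable_interpIndicator ν).aemeasurable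
    (ae_of_all _ (interpIndicator_mem_Icc ν u))

lemma integral_interpIndicator (hu : u ∈ Icc 0 1) : ∫ x, interpIndicator ν u x ∂ν = u := by
  rcases hu.1.eq_or_lt with rfl | h0
  · simp [interpIndicator_of_nonpos ν le_rfl]
  rcases hu.2.eq_or_lt with rfl | h1
  · simp [interpIndicator_of_one_le ν le_rfl]
  have hu' : u ∈ Ioo 0 1 := ⟨h0, h1⟩
  simp_rw [interpIndicator_of_mem_Ioo ν hu']
  have h_int {s : Set ℝ} (hs : MeasurableSet s) : Integrable (s.indicator (1 : ℝ → ℝ)) ν :=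
    (integrable_const 1).indicator hs
  rw [integral_add (h_int measurableSet_Iio) ((h_int (measurableSet_singleton _)).const_mul _),
    integral_const_mul, integral_indicator_one measurableSet_Iio,
    integral_indicator_one (measurableSet_singleton _)]
  have h2 := measureReal_Iio_quantile_le ν hu'
  have h3 := le_measureReal_Iio_add_singleton_quantile ν hu'
  rcases eq_or_ne (ν.real {quantile ν u}) 0 with h | h
  · rw [h] at h3 ⊢
    simp only [mul_zero]
    linarith
  · rw [div_mul_cancel₀ _ h]
    ring

lemma interpIndicator_cdf_ae_eq (z : ℝ) :
    interpIndicator ν (cdf ν z) =ᵐ[ν] (Iic z).indicator 1 := by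
  have h_int : Integrable ((Iic z).indicator (1 : ℝ → ℝ)) ν :=
    (integrable_const 1).indicator measurableSet_Iic
  have hmem : cdf ν z ∈ Icc (0 : ℝ) 1 := ⟨cdf_nonneg ν z, cdf_le_one ν z⟩
  have heq : ∫ x, interpIndicator ν (cdf ν z) x ∂ν = ∫ x, (Iic z).indicator 1 x ∂ν := by
    rw [integral_interpIndicator ν hmem, integral_indicator_one measurableSet_Iic, cdf_eq_real]
  rcases hmem.2.eq_or_lt with h1 | h1
  · refine (((integral_eq_iff_of_ae_le h_int (integrable_interpIndicator ν)
      (ae_of_all _ fun x ↦ ?_)).1 heq.symm)).symm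
    rw [interpIndicator_of_one_le ν h1.ge]
    exact indicator_le_self' (by simp) x
  · refine (integral_eq_iff_of_ae_le (integrable_interpIndicator ν) h_int
      (ae_of_all _ fun x ↦ ?_)).1 heq
    rcases hmem.1.eq_or_lt with h0 | h0
    · rw [interpIndicator_of_nonpos ν h0.ge]
      exact indicator_nonneg (by simp) x
    · refine (interpIndicator_le_indicator_Iic ν ⟨h0, h1⟩ x).trans ?_
      exact indicator_le_indicator_of_subset
        (Iic_subset_Iic.2 ((quantile_le_iff ν ⟨h0, h1⟩ z).2 le_rfl)) (by simp) x

end InterpIndicator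

lemma exists_isCopula2_of_marginals (ν₁ ν₂ : Measure ℝ) [IsProbabilityMeasure ν₁]
    [IsProbabilityMeasure ν₂] (μ : Measure (ℝ × ℝ)) [IsProbabilityMeasure μ]
    (h₁ : μ.map Prod.fst = ν₁) (h₂ : μ.map Prod.snd = ν₂) :
    ∃ C, IsCopula2 C ∧ ∀ x₁ x₂, μ.real (Iic (x₁, x₂)) = C (cdf ν₁ x₁) (cdf ν₂ x₂) := by
  set g := interpIndicator ν₁
  set h := interpIndicator ν₂
  have hg_meas (u : ℝ) : Measurable fun p : ℝ × ℝ ↦ g u p.1 :=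
    (measurable_interpIndicator ν₁).comp measurable_fst
  have hh_meas (u : ℝ) : Measurable fun p : ℝ × ℝ ↦ h u p.2 :=
    (measurable_interpIndicator ν₂).comp measurable_snd
  have h_int (u v : ℝ) : Integrable (fun p : ℝ × ℝ ↦ g u p.1 * h v p.2) μ := by
    refine Integrable.of_mem_Icc 0 1 ((hg_meas u).mul (hh_meas v)).aemeasurable
      (ae_of_all _ fun p ↦ ?_)
    have hg := interpIndicator_mem_Icc ν₁ u p.1
    have hh := interpIndicator_mem_Icc ν₂ v p.2
    exact ⟨mul_nonneg hg.1 hh.1, mul_le_one₀ hg.2 hh.1 hh.2⟩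
  refine ⟨fun u v ↦ ∫ p, g u p.1 * h v p.2 ∂μ, ⟨fun u hu ↦ ⟨?_, ?_, ?_, ?_⟩, ?_⟩, fun x₁ x₂ ↦ ?_⟩
  · simp [h, interpIndicator_of_nonpos]
  · simp [g, interpIndicator_of_nonpos]
  · simp only [h, interpIndicator_of_one_le ν₂ le_rfl, mul_one]
    have := integral_map (μ := μ) measurable_fst.aemeasurable
      (measurable_interpIndicator ν₁ (u := u)).aestronglyMeasurable
    rw [← this, h₁, integral_interpIndicator ν₁ hu]
  · simp only [g, interpIndicator_of_one_le ν₁ le_rfl, one_mul]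
    have := integral_map (μ := μ) measurable_snd.aemeasurable
      (measurable_interpIndicator ν₂ (u := u)).aestronglyMeasurable
    rw [← this, h₂, integral_interpIndicator ν₂ hu]
  · intro a₁ b₁ a₂ b₂ _ _ _ _ hab₁ hab₂
    have hsplit : ∫ p, (g b₁ p.1 - g a₁ p.1) * (h b₂ p.2 - h a₂ p.2) ∂μ =
        ∫ p, g b₁ p.1 * h b₂ p.2 ∂μ - ∫ p, g a₁ p.1 * h b₂ p.2 ∂μ - ∫ p, g b₁ p.1 * h a₂ p.2 ∂μ
          + ∫ p, g a₁ p.1 * h a₂ p.2 ∂μ := by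
      rw [← integral_sub' (h_int b₁ b₂) (h_int a₁ b₂),
        ← integral_sub' ((h_int b₁ b₂).sub (h_int a₁ b₂)) (h_int b₁ a₂),
        ← integral_add' (((h_int b₁ b₂).sub (h_int a₁ b₂)).sub (h_int b₁ a₂)) (h_int a₁ a₂)]
      exact integral_congr_ae (ae_of_all _ fun p ↦ by simp only [Pi.add_apply, Pi.sub_apply]; ring)
    refine (integral_nonneg fun p ↦ ?_).trans_eq hsplit
    exact mul_nonneg (sub_nonneg.2 (interpIndicator_mono ν₁ hab₁ p.1))
      (sub_nonneg.2 (interpIndicator_mono ν₂ hab₂ p.2))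
  · have hg : ∀ᵐ p ∂μ, g (cdf ν₁ x₁) p.1 = (Iic x₁).indicator 1 p.1 := by
      have hpres : MeasurePreserving Prod.fst μ ν₁ := ⟨measurable_fst, h₁⟩
      exact hpres.quasiMeasurePreserving.ae (interpIndicator_cdf_ae_eq ν₁ x₁)
    have hh : ∀ᵐ p ∂μ, h (cdf ν₂ x₂) p.2 = (Iic x₂).indicator 1 p.2 := by
      have hpres : MeasurePreserving Prod.snd μ ν₂ := ⟨measurable_snd, h₂⟩
      exact hpres.quasiMeasurePreserving.ae (interpIndicator_cdf_ae_eq ν₂ x₂)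
    rw [← integral_indicator_one measurableSet_Iic]
    refine integral_congr_ae ?_
    filter_upwards [hg, hh] with p hp₁ hp₂
    rw [hp₁, hp₂, ← Iic_prod_Iic]
    simp only [indicator_apply, mem_prod, Pi.one_apply]
    split_ifs <;> simp_all

lemma cdf_sInf_setOf_le_cdf (ν : Measure ℝ) {u : ℝ} (hu : 0 < u) (hmem : u ∈ range (cdf ν)) :
    cdf ν (sInf {x | u ≤ cdf ν x}) = u := by
  obtain ⟨z, rfl⟩ := hmem
  have hiff := sInf_setOf_le_cdf_le_iff ν hu ⟨z, le_rfl⟩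
  exact le_antisymm (monotone_cdf ν ((hiff z).2 le_rfl)) ((hiff _).1 le_rfl)

/-- **Sklar's theorem, bivariate case.** Let `F₁, F₂` be CDFs of
one-dimensional random variables (of laws `ν₁, ν₂`). (a) Every joint law on `ℝ²`
with marginals `ν₁, ν₂` admits a copula `C` with `F(x₁,x₂) = C(F₁(x₁),F₂(x₂))`;
such a `C` is unique on `ran F₁ × ran F₂`, where it is given by
`C(u₁,u₂) = F(F₁⁻(u₁),F₂⁻(u₂))` with `F_i⁻(y) = inf{x : F_i(x) ≥ y}`.
(b) Conversely, for every copula `C`, `C(F₁(x₁),F₂(x₂))` is the joint CDF of a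
probability measure on `ℝ²` with marginals `ν₁, ν₂`. -/
theorem sklar_bivariate
    (ν₁ ν₂ : Measure ℝ) [IsProbabilityMeasure ν₁] [IsProbabilityMeasure ν₂]
    (F₁ F₂ : ℝ → ℝ)
    (hF₁ : ∀ x, F₁ x = (ν₁ (Iic x)).toReal)
    (hF₂ : ∀ x, F₂ x = (ν₂ (Iic x)).toReal) :
    -- (a) existence, uniqueness on ran F₁ × ran F₂, and the explicit formula
    (∀ μ : Measure (ℝ × ℝ), IsProbabilityMeasure μ →
      Measure.map Prod.fst μ = ν₁ → Measure.map Prod.snd μ = ν₂ →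
      (∃ C : ℝ → ℝ → ℝ, IsCopula2 C ∧
        ∀ x₁ x₂ : ℝ,
          (μ {p : ℝ × ℝ | p.1 ≤ x₁ ∧ p.2 ≤ x₂}).toReal = C (F₁ x₁) (F₂ x₂)) ∧
      (∀ C C' : ℝ → ℝ → ℝ, IsCopula2 C → IsCopula2 C' →
        (∀ x₁ x₂ : ℝ,
          (μ {p : ℝ × ℝ | p.1 ≤ x₁ ∧ p.2 ≤ x₂}).toReal = C (F₁ x₁) (F₂ x₂)) →
        (∀ x₁ x₂ : ℝ,
          (μ {p : ℝ × ℝ | p.1 ≤ x₁ ∧ p.2 ≤ x₂}).toReal = C' (F₁ x₁) (F₂ x₂)) →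
        ∀ u₁ ∈ Set.range F₁, ∀ u₂ ∈ Set.range F₂, C u₁ u₂ = C' u₁ u₂) ∧
      (∀ C : ℝ → ℝ → ℝ, IsCopula2 C →
        (∀ x₁ x₂ : ℝ,
          (μ {p : ℝ × ℝ | p.1 ≤ x₁ ∧ p.2 ≤ x₂}).toReal = C (F₁ x₁) (F₂ x₂)) →
        ∀ u₁ ∈ Set.range F₁, ∀ u₂ ∈ Set.range F₂, 0 < u₁ → 0 < u₂ →
          C u₁ u₂ =
            (μ {p : ℝ × ℝ | p.1 ≤ sInf {x | u₁ ≤ F₁ x} ∧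
                p.2 ≤ sInf {x | u₂ ≤ F₂ x}}).toReal)) ∧
    -- (b) every copula combines the marginals into a joint law
    (∀ C : ℝ → ℝ → ℝ, IsCopula2 C →
      ∃ μ : Measure (ℝ × ℝ), IsProbabilityMeasure μ ∧
        Measure.map Prod.fst μ = ν₁ ∧ Measure.map Prod.snd μ = ν₂ ∧
        ∀ x₁ x₂ : ℝ,
          (μ {p : ℝ × ℝ | p.1 ≤ x₁ ∧ p.2 ≤ x₂}).toReal = C (F₁ x₁) (F₂ x₂)) := by
  obtain rfl : F₁ = cdf ν₁ := funext fun x ↦ (hF₁ x).trans (cdf_eq_real ν₁ x).symm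
  obtain rfl : F₂ = cdf ν₂ := funext fun x ↦ (hF₂ x).trans (cdf_eq_real ν₂ x).symm
  refine ⟨fun μ hμ h₁ h₂ ↦ ⟨exists_isCopula2_of_marginals ν₁ ν₂ μ h₁ h₂, ?_, ?_⟩, fun C hC ↦ ?_⟩
  · rintro C C' - - h h' _ ⟨x₁, rfl⟩ _ ⟨x₂, rfl⟩
    rw [← h, h']
  · intro C _ h u₁ hu₁ u₂ hu₂ h0₁ h0₂
    rw [h, cdf_sInf_setOf_le_cdf ν₁ h0₁ hu₁, cdf_sInf_setOf_le_cdf ν₂ h0₂ hu₂]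
  · obtain ⟨μ, hμ, h₁, h₂, h⟩ := hC.exists_measure_of_marginals ν₁ ν₂
    refine ⟨μ, hμ, h₁, h₂, fun x₁ x₂ ↦ ?_⟩
    have hmem₂ : cdf ν₂ x₂ ∈ Icc (0 : ℝ) 1 := ⟨cdf_nonneg _ _, cdf_le_one _ _⟩
    have hnonneg := (hC.sub_left_mem_Icc (by simp) ⟨cdf_nonneg ν₁ x₁, cdf_le_one ν₁ x₁⟩ hmem₂
      (cdf_nonneg ν₁ x₁)).1
    rw [(hC.1 _ hmem₂).2.1, sub_zero] at hnonneg
    exact (congrArg ENNReal.toReal (h x₁ x₂)).trans (ENNReal.toReal_ofReal hnonneg)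
end
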